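/- Among the permutations of the 16-element set W_4^2, exactly 5,771,520 satisfy both the diagonal condition and the annihilation condition. -/

import Mathlib

/-- For a permutation `σ` of words of length `k+1` over the alphabet `Fin n`, and a letter `i`,
`fword σ i α` is the word `β` of length `k` such that `σ (β.m) = i.α` for some letter `m`,
i.e. the first `k` letters of `σ⁻¹ (i.α)`.  (The map `f_i^σ` of the paper.) -/
def fword {n k : ℕ} (σ : Equiv.Perm (Fin (k + 1) → Fin n)) (i : Fin n)
    (α : Fin k → Fin n) : Fin k → Fin n :=
  Fin.init (σ.symm (Fin.cons i α))

/-- The sets `Σ_m` associated to a family of maps `f_i : X → X`. -/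
def SigmaSet {X : Type*} {n : ℕ} (f : Fin n → X → X) : ℕ → Set (X × X)
  | 0 => {p | p.1 = p.2}
  | m + 1 => SigmaSet f m ∪ {p | ∀ i, (f i p.1, f i p.2) ∈ SigmaSet f m}

/-- The diagonal condition: `⋃ m, Σ_m = X × X` for the family `f_i^σ`. -/
def diagCond {n k : ℕ} (σ : Equiv.Perm (Fin (k + 1) → Fin n)) : Prop :=
  (⋃ m, SigmaSet (fword σ) m) = Set.univ

/-- The set `𝒲`: off-diagonal pairs of words of length `k`, together with a point `†` (`none`). -/
def OffDiag (n k : ℕ) := Option {q : (Fin k → Fin n) × (Fin k → Fin n) // q.1 ≠ q.2}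

/-- The map `f_{ij}^σ` on `𝒲`: it sends `(α,β)` to `(γ,δ)` if `σ(γm) = iα` and `σ(δm) = jβ`
for some letter `m`, and to `†` otherwise; `†` is fixed. -/
def fpair {n k : ℕ} (σ : Equiv.Perm (Fin (k + 1) → Fin n)) (i j : Fin n) :
    OffDiag n k → OffDiag n k
  | none => none
  | some ⟨(α, β), _⟩ =>
      if h : (σ.symm (Fin.cons i α)) (Fin.last k) = (σ.symm (Fin.cons j β)) (Fin.last k) ∧
          Fin.init (σ.symm (Fin.cons i α)) ≠ Fin.init (σ.symm (Fin.cons j β)) then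
        some ⟨(Fin.init (σ.symm (Fin.cons i α)), Fin.init (σ.symm (Fin.cons j β))), h.2⟩
      else none

/-- The sets `Ψ_m` associated to a family of maps `g_j : Y → Y` and a point `†`. -/
def PsiSet {Y ι : Type*} (dag : Y) (g : ι → Y → Y) : ℕ → Set Y
  | 0 => {dag}
  | m + 1 => {dag} ∪ {y | ∀ j, g j y ∈ PsiSet dag g m}

/-- The annihilation condition: `⋃ m, Ψ_m = 𝒲` for the family `f_{ij}^σ`. -/
def annCond {n k : ℕ} (σ : Equiv.Perm (Fin (k + 1) → Fin n)) : Prop :=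
  (⋃ m, PsiSet (none : OffDiag n k) (fun ij : Fin n × Fin n => fpair σ ij.1 ij.2) m) = Set.univ

/-- Words of length four (over the positions `i`), with letters in `Fin 4`. -/
abbrev Wd := Fin 4 → Fin 4

/-- The graph on off-diagonal pairs induced by a family of maps. -/
def GRel {X I : Type} (f : I → X → X) (q p : X × X) : Prop :=
  p.1 ≠ p.2 ∧ q.1 ≠ q.2 ∧ ∃ i, q = (f i p.1, f i p.2)

/-- The family `a ↦ (i ↦ F a i)` is coalescing. -/
def Coal (F : Fin 4 → Wd) : Prop := WellFounded (GRel (fun (i : Fin 4) a => F a i))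

lemma sigma_mono {X : Type} {n : ℕ} (f : Fin n → X → X) : Monotone (SigmaSet f) :=
  monotone_nat_of_le_succ fun _ => Set.subset_union_left

lemma psi_mono {Y ι : Type} (d : Y) (g : ι → Y → Y) : Monotone (PsiSet d g) := by
  refine monotone_nat_of_le_succ fun m => ?_
  induction m with
  | zero => exact Set.subset_union_left
  | succ m ih =>
    rintro y (hy | hy)
    · exact Or.inl hy
    · exact Or.inr fun j => ih (hy j)

lemma exists_uniform {ι : Type} [Finite ι] (P : ι → ℕ → Prop)
    (hm : ∀ i m n, m ≤ n → P i m → P i n) (h : ∀ i, ∃ m, P i m) : ∃ m, ∀ i, P i m := by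
  choose g hg using h
  obtain ⟨M, hM⟩ := Finite.bddAbove_range g
  exact ⟨M, fun i => hm i _ _ (hM ⟨i, rfl⟩) (hg i)⟩

lemma sigma_iff {X : Type} {n : ℕ} (f : Fin n → X → X) :
    (⋃ m, SigmaSet f m) = Set.univ ↔ WellFounded (GRel f) := by
  constructor
  · intro h
    have key : ∀ m, ∀ p ∈ SigmaSet f m, Acc (GRel f) p := by
      intro m
      induction m with
      | zero => exact fun p hp => ⟨_, fun q hq => absurd hp hq.1⟩
      | succ m ih =>
        rintro p (hp | hp)
        · exact ih p hp
        · refine ⟨_, fun q hq => ?_⟩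
          obtain ⟨_, _, i, rfl⟩ := hq
          exact ih _ (hp i)
    refine ⟨fun p => ?_⟩
    have hp : p ∈ ⋃ m, SigmaSet f m := by rw [h]; trivial
    obtain ⟨m, hm⟩ := Set.mem_iUnion.1 hp
    exact key m p hm
  · intro h
    refine Set.eq_univ_of_forall fun p => ?_
    refine h.induction (C := fun p => p ∈ ⋃ m, SigmaSet f m) p fun p ih => ?_
    by_cases hp : p.1 = p.2
    · exact Set.mem_iUnion.2 ⟨0, hp⟩
    · obtain ⟨M, hM⟩ := exists_uniform (fun i m => (f i p.1, f i p.2) ∈ SigmaSet f m)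
        (fun i m n hmn hx => sigma_mono f hmn hx) (fun i => by
          by_cases hq : f i p.1 = f i p.2
          · exact ⟨0, hq⟩
          · exact Set.mem_iUnion.1 (ih _ ⟨hp, hq, i, rfl⟩))
      exact Set.mem_iUnion.2 ⟨M + 1, Or.inr hM⟩

/-- The graph of the annihilation condition. -/
def QRel {n k : ℕ} (σ : Equiv.Perm (Fin (k + 1) → Fin n))
    (q p : (Fin k → Fin n) × (Fin k → Fin n)) : Prop :=
  p.1 ≠ p.2 ∧ q.1 ≠ q.2 ∧ ∃ i j : Fin n,
    (σ.symm (Fin.cons i p.1) : Fin (k + 1) → Fin n) (Fin.last k) =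
      (σ.symm (Fin.cons j p.2) : Fin (k + 1) → Fin n) (Fin.last k) ∧
    q = (Fin.init (σ.symm (Fin.cons i p.1) : Fin (k + 1) → Fin n),
      Fin.init (σ.symm (Fin.cons j p.2) : Fin (k + 1) → Fin n))

lemma ann_iff {n k : ℕ} (σ : Equiv.Perm (Fin (k + 1) → Fin n)) :
    annCond σ ↔ WellFounded (QRel σ) := by
  unfold annCond
  set g : Fin n × Fin n → OffDiag n k → OffDiag n k := fun ij => fpair σ ij.1 ij.2 with hg
  constructor
  · intro h
    have key : ∀ m, ∀ y ∈ PsiSet (none : OffDiag n k) g m,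
        ∀ p hp, y = some ⟨p, hp⟩ → Acc (QRel σ) p := by
      intro m
      induction m with
      | zero => rintro y hy p hp rfl; cases hy
      | succ m ih =>
        rintro y (hy | hy) p hp rfl
        · cases hy
        · refine ⟨_, fun q hq => ?_⟩
          obtain ⟨_, hq1, i, j, h1, rfl⟩ := hq
          refine ih _ (hy (i, j)) _ hq1 ?_
          obtain ⟨α, β⟩ := p
          simp only [hg, fpair]
          exact dif_pos ⟨h1, hq1⟩
    refine ⟨fun p => ?_⟩
    by_cases hp : p.1 = p.2
    · exact ⟨_, fun q hq => absurd hp hq.1⟩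
    have hp' : (some ⟨p, hp⟩ : OffDiag n k) ∈ ⋃ m, PsiSet (none : OffDiag n k) g m := by
      rw [h]; trivial
    obtain ⟨m, hm⟩ := Set.mem_iUnion.1 hp'
    exact key m _ hm p hp rfl
  · intro h
    refine Set.eq_univ_of_forall fun y => ?_
    rcases y with _ | ⟨p, hp⟩
    · exact Set.mem_iUnion.2 ⟨0, rfl⟩
    revert hp
    refine h.induction (C := fun p => ∀ hp, (some ⟨p, hp⟩ : OffDiag n k) ∈
      ⋃ m, PsiSet (none : OffDiag n k) g m) p fun p ih hp => ?_
    obtain ⟨M, hM⟩ := exists_uniform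
      (fun ij m => g ij (some ⟨p, hp⟩) ∈ PsiSet (none : OffDiag n k) g m)
      (fun i m n hmn hx => psi_mono _ g hmn hx) (fun ij => by
        by_cases hc : (σ.symm (Fin.cons ij.1 p.1) : Fin (k + 1) → Fin n) (Fin.last k) =
            (σ.symm (Fin.cons ij.2 p.2) : Fin (k + 1) → Fin n) (Fin.last k) ∧
            Fin.init (σ.symm (Fin.cons ij.1 p.1) : Fin (k + 1) → Fin n) ≠
              Fin.init (σ.symm (Fin.cons ij.2 p.2) : Fin (k + 1) → Fin n)
        · obtain ⟨m, hm⟩ := Set.mem_iUnion.1 (ih _ ⟨hp, hc.2, ij.1, ij.2, hc.1, rfl⟩ hc.2)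
          refine ⟨m, ?_⟩
          have hE : g ij (some ⟨p, hp⟩) = some ⟨_, hc.2⟩ := dif_pos hc
          rw [hE]
          exact hm
        · refine ⟨0, ?_⟩
          exact dif_neg hc)
    exact Set.mem_iUnion.2 ⟨M + 1, Or.inr hM⟩

lemma wf_swap {X : Type} [Finite X] {r : X → X → Prop} (h : WellFounded r) :
    WellFounded (Function.swap r) := by
  have h2 : WellFounded (Relation.TransGen r) := h.transGen
  have : IsTrans X (Relation.TransGen (Function.swap r)) := ⟨fun _ _ _ => Relation.TransGen.trans⟩
  have : Std.Irrefl (Relation.TransGen (Function.swap r)) := ⟨fun a ha =>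
    h2.irrefl.irrefl a (Relation.transGen_swap.1 ha)⟩
  have h3 := Finite.wellFounded_of_trans_of_irrefl (Relation.TransGen (Function.swap r))
  exact Subrelation.wf (fun hx => Relation.TransGen.single hx) h3

/-- Transport of the permutation to pairs of letters. -/
def toPair : Equiv.Perm (Fin (1 + 1) → Fin 4) ≃ Equiv.Perm (Fin 4 × Fin 4) :=
  (Equiv.inv _).trans (finTwoArrowEquiv (Fin 4)).permCongr

def FF (e : Equiv.Perm (Fin 4 × Fin 4)) (a i : Fin 4) : Fin 4 := (e (i, a)).1

def AA (e : Equiv.Perm (Fin 4 × Fin 4)) (b m : Fin 4) : Fin 4 := (e.symm (b, m)).2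

lemma toPair_apply (σ : Equiv.Perm (Fin (1 + 1) → Fin 4)) (i a : Fin 4) :
    toPair σ (i, a) = (σ.symm ![i, a] 0, σ.symm ![i, a] 1) := rfl

lemma cons_eq (i : Fin 4) (α : Fin 1 → Fin 4) :
    (Fin.cons i α : Fin (1 + 1) → Fin 4) = ![i, α 0] := by
  funext x; fin_cases x <;> rfl

lemma wf_iff_of_inj {X Y : Type} {r : X → X → Prop} {s : Y → Y → Prop} (e : X ≃ Y)
    (h : ∀ x y, r x y ↔ s (e x) (e y)) : WellFounded r ↔ WellFounded s := by
  let E : r ≃r s := ⟨e, by intro a b; exact (h a b).symm⟩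
  exact ⟨fun hr => E.symm.toRelEmbedding.wellFounded hr, fun hs => E.toRelEmbedding.wellFounded hs⟩

def e1 : (Fin 1 → Fin 4) × (Fin 1 → Fin 4) ≃ Fin 4 × Fin 4 :=
  (Equiv.funUnique (Fin 1) (Fin 4)).prodCongr (Equiv.funUnique (Fin 1) (Fin 4))

lemma e1_apply (p : (Fin 1 → Fin 4) × (Fin 1 → Fin 4)) : e1 p = (p.1 0, p.2 0) := rfl

lemma fun1_ext {α β : Fin 1 → Fin 4} : α = β ↔ α 0 = β 0 :=
  ⟨fun h => by rw [h], fun h => by funext x; rw [Subsingleton.elim x 0]; exact h⟩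

lemma diag_iff (σ : Equiv.Perm (Fin (1 + 1) → Fin 4)) :
    diagCond σ ↔ Coal (FF (toPair σ)) := by
  unfold diagCond Coal
  rw [sigma_iff]
  refine wf_iff_of_inj e1 fun q p => ?_
  simp only [GRel, e1_apply, ne_eq, fun1_ext, Prod.ext_iff, FF, toPair_apply, fword, cons_eq]
  rfl

lemma ann_coal (σ : Equiv.Perm (Fin (1 + 1) → Fin 4)) :
    annCond σ ↔ Coal (AA (toPair σ)) := by
  rw [ann_iff]
  have h1 : WellFounded (QRel σ) ↔
      WellFounded (Function.swap (GRel (fun (i : Fin 4) a => AA (toPair σ) a i))) := by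
    refine wf_iff_of_inj e1 fun q p => ?_
    simp only [QRel, Function.swap, GRel, e1_apply, ne_eq, fun1_ext, Prod.ext_iff, cons_eq]
    have hA : ∀ b m a, AA (toPair σ) b m = a ↔ ∃ i, toPair σ (i, a) = (b, m) := by
      intro b m a
      constructor
      · rintro rfl
        exact ⟨((toPair σ).symm (b, m)).1, by simp [AA]⟩
      · rintro ⟨i, hi⟩
        simp [AA, ← hi]
    have hi : ∀ v : Fin (1 + 1) → Fin 4, (Fin.init v : Fin 1 → Fin 4) 0 = v 0 := fun v => rfl
    have hl : Fin.last 1 = 1 := rfl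
    simp only [hi, hl]
    constructor
    · rintro ⟨hp, hq, i, j, hm, h2, h3⟩
      refine ⟨hq, hp, σ.symm ![i, p.1 0] 1, ?_, ?_⟩
      · symm; rw [hA]; exact ⟨i, by rw [toPair_apply, h2]⟩
      · symm; rw [hA]; exact ⟨j, by rw [toPair_apply, h3, hm]⟩
    · rintro ⟨hq, hp, m, h2, h3⟩
      obtain ⟨i, hi⟩ := (hA _ _ _).1 h2.symm
      obtain ⟨j, hj⟩ := (hA _ _ _).1 h3.symm
      rw [toPair_apply, Prod.ext_iff] at hi hj
      exact ⟨hp, hq, i, j, hi.2.trans hj.2.symm, hi.1.symm, hj.1.symm⟩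
  rw [h1]
  exact ⟨fun h => wf_swap h, fun h => wf_swap h⟩

/-- Equivalences over a base are families of equivalences of fibres. -/
def fibEquiv {X Y Z : Type} (p : X → Z) (q : Y → Z) :
    {e : X ≃ Y // ∀ x, q (e x) = p x} ≃ ∀ z, ({x // p x = z} ≃ {y // q y = z}) where
  toFun e z := e.1.subtypeEquiv (fun x => by rw [e.2])
  invFun g := ⟨Equiv.ofFiberEquiv g, Equiv.ofFiberEquiv_map g⟩
  left_inv e := by
    ext x
    simp [Equiv.ofFiberEquiv]
  right_inv g := by
    ext z ⟨x, rfl⟩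
    rfl

open Classical in
lemma fib_card {X Y Z : Type} [Finite X] [Finite Y] [Fintype Z] (p : X → Z) (q : Y → Z) :
    Nat.card {e : X ≃ Y // ∀ x, q (e x) = p x} =
      if ∀ z, Nat.card {x // p x = z} = Nat.card {y // q y = z} then
        ∏ z, (Nat.card {x // p x = z}).factorial else 0 := by
  rw [Nat.card_congr (fibEquiv p q), Nat.card_pi]
  split_ifs with h
  · refine Finset.prod_congr rfl fun z _ => ?_
    have := Fintype.ofFinite X
    have := Fintype.ofFinite Y
    have h1 := h z
    have : Nonempty ({x // p x = z} ≃ {y // q y = z}) := Finite.card_eq.1 h1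
    obtain ⟨e⟩ := this
    rw [Nat.card_eq_fintype_card, Fintype.card_equiv e, Nat.card_eq_fintype_card]
  · push Not at h
    obtain ⟨z, hz⟩ := h
    refine Finset.prod_eq_zero (Finset.mem_univ z) ?_
    have : IsEmpty ({x // p x = z} ≃ {y // q y = z}) := ⟨fun e => hz (Nat.card_congr e)⟩
    exact Nat.card_of_isEmpty

/-- Number of occurrences of the letter `x` in the word `w`. -/
noncomputable def cnt (w : Wd) (x : Fin 4) : ℕ := Nat.card {i // w i = x}

open Classical in
/-- Indicator of the coalescing families. -/
noncomputable def chi (F : Fin 4 → Wd) : ℕ := if Coal F then 1 else 0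

open Classical in
/-- Number of permutations with given data. -/
noncomputable def mult (F A : Fin 4 → Wd) : ℕ :=
  if ∀ a b, cnt (F a) b = cnt (A b) a then ∏ a, ∏ b, (cnt (F a) b).factorial else 0

lemma card_fibre (F A : Fin 4 → Wd) :
    Nat.card {e : Equiv.Perm (Fin 4 × Fin 4) // FF e = F ∧ AA e = A} = mult F A := by
  classical
  let p : Fin 4 × Fin 4 → Fin 4 × Fin 4 := fun x => (x.2, F x.2 x.1)
  let q : Fin 4 × Fin 4 → Fin 4 × Fin 4 := fun y => (A y.1 y.2, y.1)
  have h1 : ∀ e : Equiv.Perm (Fin 4 × Fin 4), (FF e = F ∧ AA e = A) ↔ ∀ x, q (e x) = p x := by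
    intro e
    constructor
    · rintro ⟨rfl, rfl⟩ ⟨i, a⟩
      simp [p, q, FF, AA]
    · intro h
      constructor
      · funext a i
        have := h (i, a)
        simp only [p, q, Prod.mk.injEq] at this
        exact this.2
      · funext b m
        have := h (e.symm (b, m))
        simp only [p, q, Prod.mk.injEq, Equiv.apply_symm_apply] at this
        exact this.1.symm
  have hp : ∀ a b, Nat.card {x // p x = (a, b)} = cnt (F a) b := by
    intro a b
    refine Nat.card_congr ⟨fun x => ⟨x.1.1, ?_⟩, fun i => ⟨(i.1, a), ?_⟩, ?_, ?_⟩
    · have := x.2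
      simp only [p, Prod.mk.injEq] at this
      exact (congrArg (fun t => F t x.1.1) this.1).symm.trans this.2
    · simp [p, i.2]
    · rintro ⟨⟨i, a'⟩, h⟩
      simp only [p, Prod.mk.injEq] at h
      simp [h.1]
    · rintro ⟨i, h⟩; rfl
  have hq : ∀ a b, Nat.card {y // q y = (a, b)} = cnt (A b) a := by
    intro a b
    refine Nat.card_congr ⟨fun x => ⟨x.1.2, ?_⟩, fun i => ⟨(b, i.1), ?_⟩, ?_, ?_⟩
    · have := x.2
      simp only [q, Prod.mk.injEq] at this
      exact (congrArg (fun t => A t x.1.2) this.2).symm.trans this.1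
    · simp [q, i.2]
    · rintro ⟨⟨b', m⟩, h⟩
      simp only [q, Prod.mk.injEq] at h
      simp [h.2]
    · rintro ⟨i, h⟩; rfl
  rw [Nat.card_congr (Equiv.subtypeEquivRight h1), fib_card, mult, Fintype.prod_prod_type]
  simp only [Prod.forall, hp, hq]

open Classical in
lemma card_double {E U V : Type} [Fintype E] [Fintype U] [Fintype V] (P : U → Prop) (Q : V → Prop)
    (f : E → U) (g : E → V) : Nat.card {e // P (f e) ∧ Q (g e)} =
      ∑ u, ∑ v, (if P u then 1 else 0) * (if Q v then 1 else 0) *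
        Nat.card {e // f e = u ∧ g e = v} := by
  rw [Nat.card_eq_fintype_card, Fintype.card_subtype,
    Finset.card_eq_sum_card_fiberwise (f := fun e => (f e, g e)) (t := Finset.univ)
      (fun _ _ => Finset.mem_coe.2 (Finset.mem_univ _)), ← Finset.univ_product_univ,
    Finset.sum_product]
  refine Finset.sum_congr rfl fun F _ => Finset.sum_congr rfl fun A _ => ?_
  rw [Nat.card_eq_fintype_card, Fintype.card_subtype, Finset.filter_filter]
  by_cases hF : P F
  · by_cases hA : Q A
    · simp only [hF, hA, if_true, one_mul]
      congr 1
      ext e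
      simp only [Finset.mem_filter, Finset.mem_univ, true_and, Prod.mk.injEq]
      constructor
      · exact fun h => h.2
      · rintro ⟨rfl, rfl⟩
        exact ⟨⟨hF, hA⟩, rfl, rfl⟩
    · simp only [hA, if_false, mul_zero, zero_mul, Finset.card_eq_zero]
      ext e
      simp only [Finset.mem_filter, Finset.mem_univ, true_and, Prod.mk.injEq]
      constructor
      · rintro ⟨⟨_, h⟩, rfl, rfl⟩
        exact absurd h hA
      · simp
  · simp only [hF, if_false, zero_mul, Finset.card_eq_zero]
    ext e
    simp only [Finset.mem_filter, Finset.mem_univ, true_and, Prod.mk.injEq]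
    constructor
    · rintro ⟨⟨h, _⟩, rfl, rfl⟩
      exact absurd h hF
    · simp

lemma main_sum : Nat.card {σ : Equiv.Perm (Fin (1 + 1) → Fin 4) // diagCond σ ∧ annCond σ} =
    ∑ F : Fin 4 → Wd, ∑ A : Fin 4 → Wd, chi F * chi A * mult F A := by
  have h1 : Nat.card {σ : Equiv.Perm (Fin (1 + 1) → Fin 4) // diagCond σ ∧ annCond σ} =
      Nat.card {e : Equiv.Perm (Fin 4 × Fin 4) // Coal (FF e) ∧ Coal (AA e)} := by
    refine Nat.card_congr (toPair.subtypeEquiv fun σ => ?_)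
    rw [diag_iff, ann_coal]
  rw [h1, card_double]
  refine Finset.sum_congr rfl fun F _ => Finset.sum_congr rfl fun A _ => ?_
  rw [← card_fibre]
  rfl

def tbl : List (ℕ × List ℕ) := [
  (4, [0]),
  (35, [1, 4, 16, 64]),
  (66, [5, 17, 20, 65, 68, 80]),
  (97, [21, 69, 81, 84]),
  (128, [85]),
  (1027, [2, 8, 32, 128]),
  (1058, [6, 9, 18, 24, 33, 36, 66, 72, 96, 129, 132, 144]),
  (1089, [22, 25, 37, 70, 73, 82, 88, 97, 100, 133, 145, 148]),
  (1120, [86, 89, 101, 149]),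
  (2050, [10, 34, 40, 130, 136, 160]),
  (2081, [26, 38, 41, 74, 98, 104, 134, 137, 146, 152, 161, 164]),
  (2112, [90, 102, 105, 150, 153, 165]),
  (3073, [42, 138, 162, 168]),
  (3104, [106, 154, 166, 169]),
  (4096, [170]),
  (32771, [3, 12, 48, 192]),
  (32802, [7, 13, 19, 28, 49, 52, 67, 76, 112, 193, 196, 208]),
  (32833, [23, 29, 53, 71, 77, 83, 92, 113, 116, 197, 209, 212]),
  (32864, [87, 93, 117, 213]),
  (33794, [11, 14, 35, 44, 50, 56, 131, 140, 176, 194, 200, 224]),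
  (33825, [27, 30, 39, 45, 54, 57, 75, 78, 99, 108, 114, 120, 135, 141, 147, 156, 177, 180, 198, 201, 210, 216, 225, 228]),
  (33856, [91, 94, 103, 109, 118, 121, 151, 157, 181, 214, 217, 229]),
  (34817, [43, 46, 58, 139, 142, 163, 172, 178, 184, 202, 226, 232]),
  (34848, [107, 110, 122, 155, 158, 167, 173, 182, 185, 218, 230, 233]),
  (35840, [171, 174, 186, 234]),
  (65538, [15, 51, 60, 195, 204, 240]),
  (65569, [31, 55, 61, 79, 115, 124, 199, 205, 211, 220, 241, 244]),
  (65600, [95, 119, 125, 215, 221, 245]),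
  (66561, [47, 59, 62, 143, 179, 188, 203, 206, 227, 236, 242, 248]),
  (66592, [111, 123, 126, 159, 183, 189, 219, 222, 231, 237, 246, 249]),
  (67584, [175, 187, 190, 235, 238, 250]),
  (98305, [63, 207, 243, 252]),
  (98336, [127, 223, 247, 253]),
  (99328, [191, 239, 251, 254]),
  (131072, [255])]

/-- The `i`-th base-4 digit of `w`. -/
def dg (w i : ℕ) : ℕ := Nat.mod (Nat.div w (Nat.pow (nat_lit 4) i)) (nat_lit 4)

/-- Positions of the letter `a` in the word coded by `w`, as a bit mask. -/
def zm (w a : ℕ) : ℕ :=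
  Nat.add (cond (Nat.beq (dg w (nat_lit 0)) a) (nat_lit 1) (nat_lit 0))
    (Nat.add (cond (Nat.beq (dg w (nat_lit 1)) a) (nat_lit 2) (nat_lit 0))
      (Nat.add (cond (Nat.beq (dg w (nat_lit 2)) a) (nat_lit 4) (nat_lit 0))
        (cond (Nat.beq (dg w (nat_lit 3)) a) (nat_lit 8) (nat_lit 0))))

/-- The pair `{a, b}` is not mapped to itself by any of the letters. -/
def okp (a b wa wb : ℕ) : Bool :=
  cond (Nat.beq (Nat.land (zm wa a) (zm wb b)) (nat_lit 0))
    (Nat.beq (Nat.land (zm wa b) (zm wb a)) (nat_lit 0)) false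

def lsum {α : Type} (l : List α) (f : α → ℕ) : ℕ :=
  List.rec 0 (fun x _ ih => Nat.add (f x) ih) l

def msk (L : List (ℕ × ℕ)) : ℕ := List.rec 0 (fun x _ ih => Nat.lor x.1 ih) L

def lfilter {α : Type} (f : α → Bool) (l : List α) : List α :=
  List.rec [] (fun x _ ih => bif f x then x :: ih else ih) l

def llen {α : Type} (l : List α) : ℕ := List.rec 0 (fun _ _ ih => Nat.add ih 1) l

def pstep (L : List (ℕ × ℕ)) : List (ℕ × ℕ) :=
  lfilter (fun x => !(Nat.beq (Nat.land x.2 (msk L)) 0)) L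

def go (k : ℕ) : List (ℕ × ℕ) → Bool :=
  Nat.rec (fun L => L.isEmpty)
    (fun _ ih L => bif Nat.beq (llen (pstep L)) (llen L) then L.isEmpty else ih (pstep L)) k

def bt (wa wb i : ℕ) : ℕ := 2 ^ (4 * dg wa i + dg wb i)

def nd (a b wa wb : ℕ) : ℕ × ℕ :=
  (2 ^ (4 * a + b), Nat.lor (bt wa wb 0) (Nat.lor (bt wa wb 1) (Nat.lor (bt wa wb 2) (bt wa wb 3))))

def coalB (w0 w1 w2 w3 : ℕ) : Bool :=
  go 12 [nd 0 1 w0 w1, nd 0 2 w0 w2, nd 0 3 w0 w3, nd 1 0 w1 w0, nd 1 2 w1 w2, nd 1 3 w1 w3,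
    nd 2 0 w2 w0, nd 2 1 w2 w1, nd 2 3 w2 w3, nd 3 0 w3 w0, nd 3 1 w3 w1, nd 3 2 w3 w2]

def eq4 (x y z t : ℕ) : Bool :=
  Nat.beq x y || (Nat.beq x z || (Nat.beq x t || (Nat.beq y z || (Nat.beq y t || Nat.beq z t))))

def wordsOf (r : ℕ) : List ℕ :=
  List.rec [] (fun x _ ih => bif Nat.beq r x.1 then x.2 else ih) tbl

def dcnt (l0 l1 l2 l3 : List ℕ) : ℕ :=
  List.rec 0 (fun w0 _ _ => Nat.mul (llen l0) (lsum l1 fun w1 =>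
    bif okp (nat_lit 0) (nat_lit 1) w0 w1 then lsum l2 fun w2 =>
      bif okp (nat_lit 0) (nat_lit 2) w0 w2 && okp (nat_lit 1) (nat_lit 2) w1 w2 then lsum l3 fun w3 =>
        bif eq4 w0 w1 w2 w3 && (okp (nat_lit 0) (nat_lit 3) w0 w3 && (okp (nat_lit 1) (nat_lit 3) w1 w3 && okp (nat_lit 2) (nat_lit 3) w2 w3)) then
          bif coalB w0 w1 w2 w3 then 1 else 0
        else 0
      else 0
    else 0)) l0

def en (r b : ℕ) : ℕ := r / 32 ^ b % 32

def tr (r0 r1 r2 r3 b : ℕ) : ℕ := en r0 b + 32 * en r1 b + 1024 * en r2 b + 32768 * en r3 b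

def fc (n : ℕ) : ℕ := Nat.rec 1 (fun k ih => Nat.mul (k + 1) ih) n

def wtr (r : ℕ) : ℕ := fc (en r 0) * fc (en r 1) * fc (en r 2) * fc (en r 3)

def dr (r0 r1 r2 r3 : ℕ) : ℕ := dcnt (wordsOf r0) (wordsOf r1) (wordsOf r2) (wordsOf r3)

def term (r0 r1 r2 r3 : ℕ) : ℕ :=
  bif eq4 r0 r1 r2 r3 && ((eq4 (tr r0 r1 r2 r3 0) (tr r0 r1 r2 r3 1) (tr r0 r1 r2 r3 2) (tr r0 r1 r2 r3 3))) then
    Nat.rec 0 (fun d _ => Nat.mul (d + 1) (Nat.mul (wtr r0 * wtr r1 * wtr r2 * wtr r3)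
      (dr (tr r0 r1 r2 r3 0) (tr r0 r1 r2 r3 1) (tr r0 r1 r2 r3 2) (tr r0 r1 r2 r3 3))))
      (dr r0 r1 r2 r3)
  else 0

/-- all base-32 digits of `s` are at most 4 -/
def filt (s : ℕ) : Bool := Nat.beq (Nat.land (676500 - s) 541200) 541200

def total : ℕ :=
  lsum tbl fun x0 => lsum tbl fun x1 => bif filt (x0.1 + x1.1) then lsum tbl fun x2 =>
    bif filt (x0.1 + x1.1 + x2.1) then
      term x0.1 x1.1 x2.1 (135300 - (x0.1 + x1.1 + x2.1)) else 0 else 0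

/-- The word coded by `c`. -/
def dec (c : ℕ) : Wd := fun i => ⟨dg c i, Nat.mod_lt _ (by norm_num)⟩

/-- The code of a word. -/
def code (w : Wd) : ℕ := (w 0 : ℕ) + 4 * (w 1 : ℕ) + 16 * (w 2 : ℕ) + 64 * (w 3 : ℕ)

lemma dg_eq (c i : ℕ) : dg c i = c / 4 ^ i % 4 := rfl

lemma dec_code (w : Wd) : dec (code w) = w := by
  have h0 := (w 0).isLt
  have h1 := (w 1).isLt
  have h2 := (w 2).isLt
  have h3 := (w 3).isLt
  funext i
  apply Fin.ext
  change dg (code w) i = w i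
  rw [dg_eq, code]
  fin_cases i <;> simp <;> omega

lemma code_lt (w : Wd) : code w < 256 := by
  have h0 := (w 0).isLt
  have h1 := (w 1).isLt
  have h2 := (w 2).isLt
  have h3 := (w 3).isLt
  rw [code]
  omega

lemma code_dec (c : ℕ) (h : c < 256) : code (dec c) = c := by
  change dg c 0 + 4 * dg c 1 + 16 * dg c 2 + 64 * dg c 3 = c
  simp only [dg_eq]
  norm_num
  omega

/-- Content of a word, encoded in base 32. -/
def cont (w : Wd) : ℕ := 32 ^ (w 0 : ℕ) + 32 ^ (w 1 : ℕ) + 32 ^ (w 2 : ℕ) + 32 ^ (w 3 : ℕ)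

def contN (c : ℕ) : ℕ := 32 ^ dg c 0 + 32 ^ dg c 1 + 32 ^ dg c 2 + 32 ^ dg c 3

lemma cont_dec (c : ℕ) : cont (dec c) = contN c := rfl

lemma cnt_eq (w : Wd) (x : Fin 4) : cnt w x = (if w 0 = x then 1 else 0) +
    (if w 1 = x then 1 else 0) + (if w 2 = x then 1 else 0) + (if w 3 = x then 1 else 0) := by
  rw [cnt, Nat.card_eq_fintype_card, Fintype.card_subtype, Finset.card_filter, Fin.sum_univ_four]

lemma en_cont (w : Wd) (x : Fin 4) : en (cont w) x = cnt w x := by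
  rw [cnt_eq, cont]
  generalize w 0 = a, w 1 = b, w 2 = c, w 3 = d
  revert a b c d x
  decide +kernel

lemma cont_eq (w : Wd) :
    cont w = cnt w 0 + 32 * cnt w 1 + 1024 * cnt w 2 + 32768 * cnt w 3 := by
  simp only [cnt_eq, cont]
  generalize w 0 = a, w 1 = b, w 2 = c, w 3 = d
  revert a b c d
  decide +kernel

lemma cnt_sum (w : Wd) : cnt w 0 + cnt w 1 + cnt w 2 + cnt w 3 = 4 := by
  simp only [cnt_eq]
  generalize w 0 = a, w 1 = b, w 2 = c, w 3 = d
  revert a b c d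
  decide +kernel

lemma lsum_eq {α : Type} (l : List α) (f : α → ℕ) : lsum l f = (l.map f).sum := by
  induction l with
  | nil => rfl
  | cons x l ih => rw [List.map_cons, List.sum_cons, ← ih]; rfl

lemma llen_eq {α : Type} (l : List α) : llen l = l.length := by
  induction l with
  | nil => rfl
  | cons x l ih => rw [List.length_cons, ← ih]; rfl

lemma tbl_spec : ∀ x ∈ tbl, x.2.Nodup ∧ ∀ c ∈ x.2, c < 256 ∧ contN c = x.1 := by
  decide +kernel

lemma tbl_complete : ∀ c < 256, c ∈ wordsOf (contN c) := by
  decide +kernel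

lemma tbl_nodup : (tbl.map Prod.fst).Nodup := by decide +kernel

lemma wordsOf_cases (r : ℕ) : wordsOf r = [] ∨ ∃ x ∈ tbl, x.1 = r ∧ wordsOf r = x.2 := by
  unfold wordsOf
  generalize tbl = l
  induction l with
  | nil => exact Or.inl rfl
  | cons y l ih =>
    by_cases h : r = y.1
    · refine Or.inr ⟨y, by simp, h.symm, ?_⟩
      have : Nat.beq r y.1 = true := by rw [h]; exact Nat.beq_refl _
      simp only [this, cond_true]
    · have : Nat.beq r y.1 = false := by
        rw [Bool.eq_false_iff]
        exact fun hh => h (Nat.eq_of_beq_eq_true hh)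
      simp only [this, cond_false]
      rcases ih with ih | ⟨x, hx, h1, h2⟩
      · exact Or.inl ih
      · exact Or.inr ⟨x, by simp [hx], h1, h2⟩

lemma mem_wordsOf (r c : ℕ) : c ∈ wordsOf r ↔ c < 256 ∧ contN c = r := by
  constructor
  · intro h
    rcases wordsOf_cases r with h0 | ⟨x, hx, h1, h2⟩
    · rw [h0] at h; simp at h
    · rw [h2] at h
      rw [← h1]
      exact (tbl_spec x hx).2 c h
  · rintro ⟨h, rfl⟩
    exact tbl_complete c h

lemma wordsOf_nodup (r : ℕ) : (wordsOf r).Nodup := by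
  rcases wordsOf_cases r with h0 | ⟨x, hx, h1, h2⟩
  · rw [h0]; exact List.nodup_nil
  · rw [h2]; exact (tbl_spec x hx).1

/-- Words of given content. -/
def SS (r : ℕ) : Finset Wd := Finset.univ.filter fun w => cont w = r

lemma mem_SS (r : ℕ) (w : Wd) : w ∈ SS r ↔ cont w = r := by simp [SS]

lemma sum_SS (r : ℕ) (g : Wd → ℕ) : ∑ w ∈ SS r, g w = lsum (wordsOf r) fun c => g (dec c) := by
  rw [lsum_eq, ← List.sum_toFinset _ (wordsOf_nodup r)]
  refine Finset.sum_nbij' code dec ?_ ?_ ?_ ?_ ?_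
  · intro w hw
    rw [List.mem_toFinset, mem_wordsOf, ← cont_dec, dec_code]
    exact ⟨code_lt w, (mem_SS _ _).1 hw⟩
  · intro c hc
    rw [List.mem_toFinset, mem_wordsOf] at hc
    rw [mem_SS, cont_dec]
    exact hc.2
  · exact fun w _ => dec_code w
  · intro c hc
    rw [List.mem_toFinset, mem_wordsOf] at hc
    exact code_dec c hc.1
  · intro w _
    rw [dec_code]

/-- The possible contents. -/
def LL : Finset ℕ := (tbl.map Prod.fst).toFinset

lemma sum_LL (g : ℕ → ℕ) : ∑ r ∈ LL, g r = lsum tbl fun x => g x.1 := by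
  rw [LL, List.sum_toFinset _ tbl_nodup, lsum_eq, List.map_map]
  rfl

lemma cont_mem (w : Wd) : cont w ∈ LL := by
  have h : code w ∈ wordsOf (cont w) := by
    rw [mem_wordsOf, ← cont_dec, dec_code]
    exact ⟨code_lt w, rfl⟩
  rcases wordsOf_cases (cont w) with h0 | ⟨x, hx, h1, -⟩
  · rw [h0] at h; simp at h
  · rw [LL, List.mem_toFinset, ← h1]
    exact List.mem_map_of_mem hx

/-- Number of coalescing families with given contents. -/
noncomputable def DD (r0 r1 r2 r3 : ℕ) : ℕ :=
  ∑ w0 ∈ SS r0, ∑ w1 ∈ SS r1, ∑ w2 ∈ SS r2, ∑ w3 ∈ SS r3, chi ![w0, w1, w2, w3]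

def quad : (Fin 4 → Wd) ≃ Wd × Wd × Wd × Wd where
  toFun F := (F 0, F 1, F 2, F 3)
  invFun q := ![q.1, q.2.1, q.2.2.1, q.2.2.2]
  left_inv F := by funext i; fin_cases i <;> rfl
  right_inv q := rfl

lemma sum_quad (g : (Fin 4 → Wd) → ℕ) (h : ℕ → ℕ → ℕ → ℕ → ℕ) :
    ∑ F : Fin 4 → Wd, g F * h (cont (F 0)) (cont (F 1)) (cont (F 2)) (cont (F 3)) =
    ∑ r0 ∈ LL, ∑ r1 ∈ LL, ∑ r2 ∈ LL, ∑ r3 ∈ LL,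
      (∑ w0 ∈ SS r0, ∑ w1 ∈ SS r1, ∑ w2 ∈ SS r2, ∑ w3 ∈ SS r3, g ![w0, w1, w2, w3]) *
        h r0 r1 r2 r3 := by
  classical
  let κ : Wd × Wd × Wd × Wd → ℕ × ℕ × ℕ × ℕ :=
    fun q => (cont q.1, cont q.2.1, cont q.2.2.1, cont q.2.2.2)
  have h1 : ∑ F : Fin 4 → Wd, g F * h (cont (F 0)) (cont (F 1)) (cont (F 2)) (cont (F 3)) =
      ∑ q : Wd × Wd × Wd × Wd, g ![q.1, q.2.1, q.2.2.1, q.2.2.2] *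
        h (cont q.1) (cont q.2.1) (cont q.2.2.1) (cont q.2.2.2) := by
    refine Fintype.sum_equiv quad _ _ fun F => ?_
    have : quad.symm (quad F) = F := quad.symm_apply_apply F
    change _ = g (quad.symm (quad F)) * _
    rw [this]
    rfl
  have hm : ∀ q ∈ (Finset.univ : Finset (Wd × Wd × Wd × Wd)),
      κ q ∈ LL ×ˢ LL ×ˢ LL ×ˢ LL := by
    intro q _
    simp only [Finset.mem_product, κ]
    exact ⟨cont_mem _, cont_mem _, cont_mem _, cont_mem _⟩
  rw [h1, ← Finset.sum_fiberwise_of_maps_to hm]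
  simp only [Finset.sum_product]
  refine Finset.sum_congr rfl fun r0 _ => Finset.sum_congr rfl fun r1 _ =>
    Finset.sum_congr rfl fun r2 _ => Finset.sum_congr rfl fun r3 _ => ?_
  have hf : Finset.univ.filter (fun q => κ q = (r0, r1, r2, r3)) =
      SS r0 ×ˢ SS r1 ×ˢ SS r2 ×ˢ SS r3 := by
    ext q
    simp only [Finset.mem_filter, Finset.mem_univ, true_and, Finset.mem_product, mem_SS, κ,
      Prod.mk.injEq]
  rw [hf, Finset.sum_product, Finset.sum_mul]
  refine Finset.sum_congr rfl fun w0 h0 => ?_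
  rw [Finset.sum_product, Finset.sum_mul]
  refine Finset.sum_congr rfl fun w1 h1 => ?_
  rw [Finset.sum_product, Finset.sum_mul]
  refine Finset.sum_congr rfl fun w2 h2 => ?_
  rw [Finset.sum_mul]
  refine Finset.sum_congr rfl fun w3 h3 => ?_
  rw [mem_SS] at h0 h1 h2 h3
  simp only [h0, h1, h2, h3]

lemma en_tr (w0 w1 w2 w3 : Wd) (a b : Fin 4) :
    en (tr (cont w0) (cont w1) (cont w2) (cont w3) b) a =
      cnt ((![w0, w1, w2, w3] : Fin 4 → Wd) a) b := by
  unfold tr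
  simp only [en_cont]
  have hle : ∀ w : Wd, cnt w b ≤ 4 := by
    intro w
    rw [cnt_eq]
    split_ifs <;> omega
  have h0 := hle w0
  have h1 := hle w1
  have h2 := hle w2
  have h3 := hle w3
  unfold en
  fin_cases a <;> simp <;> omega

lemma mult_cond (F A : Fin 4 → Wd) : (∀ a b, cnt (F a) b = cnt (A b) a) ↔
    ∀ b : Fin 4, cont (A b) = tr (cont (F 0)) (cont (F 1)) (cont (F 2)) (cont (F 3)) b := by
  constructor
  · intro h b
    rw [cont_eq]
    simp only [tr, en_cont, h]
  · intro h a b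
    have hF : (![F 0, F 1, F 2, F 3] : Fin 4 → Wd) a = F a := by fin_cases a <;> rfl
    rw [← en_cont (A b), h, en_tr, hF]

lemma fc_eq (n : ℕ) : fc n = n.factorial := by
  induction n with
  | zero => rfl
  | succ n ih => rw [Nat.factorial_succ, ← ih]; rfl

lemma wt_eq (w : Wd) : ∏ b, (cnt w b).factorial = wtr (cont w) := by
  rw [Fin.prod_univ_four, wtr]
  simp only [← en_cont, fc_eq]
  rfl

/-- The factor attached to a matrix. -/
noncomputable def GG (r0 r1 r2 r3 : ℕ) : ℕ := (wtr r0 * wtr r1 * wtr r2 * wtr r3) *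
  DD (tr r0 r1 r2 r3 0) (tr r0 r1 r2 r3 1) (tr r0 r1 r2 r3 2) (tr r0 r1 r2 r3 3)

lemma sum_mult (F : Fin 4 → Wd) : ∑ A : Fin 4 → Wd, chi A * mult F A =
    GG (cont (F 0)) (cont (F 1)) (cont (F 2)) (cont (F 3)) := by
  classical
  set t := tr (cont (F 0)) (cont (F 1)) (cont (F 2)) (cont (F 3)) with ht
  have h1 : ∀ A : Fin 4 → Wd, mult F A =
      (fun s0 s1 s2 s3 => if s0 = t 0 ∧ s1 = t 1 ∧ s2 = t 2 ∧ s3 = t 3 then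
        (wtr (cont (F 0)) * wtr (cont (F 1)) * wtr (cont (F 2)) * wtr (cont (F 3))) else 0)
      (cont (A 0)) (cont (A 1)) (cont (A 2)) (cont (A 3)) := by
    intro A
    simp only [mult]
    have hc : (∀ a b, cnt (F a) b = cnt (A b) a) ↔
        (cont (A 0) = t 0 ∧ cont (A 1) = t 1 ∧ cont (A 2) = t 2 ∧ cont (A 3) = t 3) := by
      rw [mult_cond]
      constructor
      · exact fun h => ⟨h 0, h 1, h 2, h 3⟩
      · rintro ⟨a0, a1, a2, a3⟩ b
        fin_cases b
        · exact a0
        · exact a1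
        · exact a2
        · exact a3
    refine if_congr hc ?_ rfl
    simp only [wt_eq]
    rw [Fin.prod_univ_four]
  simp only [h1]
  rw [sum_quad (fun A => chi A) (fun s0 s1 s2 s3 =>
    if s0 = t 0 ∧ s1 = t 1 ∧ s2 = t 2 ∧ s3 = t 3 then
        (wtr (cont (F 0)) * wtr (cont (F 1)) * wtr (cont (F 2)) * wtr (cont (F 3))) else 0)]
  have hD : ∀ r0 r1 r2 r3, DD r0 r1 r2 r3 ≠ 0 → r0 ∈ LL ∧ r1 ∈ LL ∧ r2 ∈ LL ∧ r3 ∈ LL := by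
    intro r0 r1 r2 r3 h
    unfold DD at h
    obtain ⟨w0, m0, h⟩ := Finset.exists_ne_zero_of_sum_ne_zero h
    obtain ⟨w1, m1, h⟩ := Finset.exists_ne_zero_of_sum_ne_zero h
    obtain ⟨w2, m2, h⟩ := Finset.exists_ne_zero_of_sum_ne_zero h
    obtain ⟨w3, m3, h⟩ := Finset.exists_ne_zero_of_sum_ne_zero h
    rw [mem_SS] at m0 m1 m2 m3
    rw [← m0, ← m1, ← m2, ← m3]
    exact ⟨cont_mem _, cont_mem _, cont_mem _, cont_mem _⟩
  change ∑ r0 ∈ LL, ∑ r1 ∈ LL, ∑ r2 ∈ LL, ∑ r3 ∈ LL, DD r0 r1 r2 r3 * _ = _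
  unfold GG
  rw [← ht]
  by_cases h0 : DD (t 0) (t 1) (t 2) (t 3) = 0
  · rw [h0, mul_zero]
    refine Finset.sum_eq_zero fun r0 _ => Finset.sum_eq_zero fun r1 _ =>
      Finset.sum_eq_zero fun r2 _ => Finset.sum_eq_zero fun r3 _ => ?_
    split_ifs with hh
    · obtain ⟨rfl, rfl, rfl, rfl⟩ := hh
      rw [h0, zero_mul]
    · rw [mul_zero]
  · obtain ⟨m0, m1, m2, m3⟩ := hD _ _ _ _ h0
    rw [Finset.sum_eq_single_of_mem (t 0) m0, Finset.sum_eq_single_of_mem (t 1) m1,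
      Finset.sum_eq_single_of_mem (t 2) m2, Finset.sum_eq_single_of_mem (t 3) m3]
    · simp [mul_comm]
    · intro r _ hr
      simp [hr]
    · intro r _ hr
      simp [hr]
    · intro r _ hr
      simp [hr]
    · intro r _ hr
      simp [hr]

lemma main_sum2 : Nat.card {σ : Equiv.Perm (Fin (1 + 1) → Fin 4) // diagCond σ ∧ annCond σ} =
    ∑ r0 ∈ LL, ∑ r1 ∈ LL, ∑ r2 ∈ LL, ∑ r3 ∈ LL, DD r0 r1 r2 r3 * GG r0 r1 r2 r3 := by
  rw [main_sum]
  have h : ∀ F : Fin 4 → Wd, ∑ A : Fin 4 → Wd, chi F * chi A * mult F A =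
      chi F * GG (cont (F 0)) (cont (F 1)) (cont (F 2)) (cont (F 3)) := by
    intro F
    rw [← sum_mult, Finset.mul_sum]
    exact Finset.sum_congr rfl fun A _ => mul_assoc _ _ _
  simp only [h]
  exact sum_quad chi GG

lemma lfilter_eq {α : Type} (f : α → Bool) (l : List α) : lfilter f l = l.filter f := by
  induction l with
  | nil => rfl
  | cons x l ih =>
    have : lfilter f (x :: l) = bif f x then x :: lfilter f l else lfilter f l := rfl
    rw [this, ih, List.filter_cons]
    cases f x <;> simp

/-- The graph on a list of nodes. -/
def rL (L : List (ℕ × ℕ)) (y x : ℕ × ℕ) : Prop := x ∈ L ∧ y ∈ L ∧ Nat.land x.2 y.1 ≠ 0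

lemma land_lor (x y z : ℕ) : Nat.land x (Nat.lor y z) = Nat.lor (Nat.land x y) (Nat.land x z) :=
  Nat.and_or_distrib_left x y z

lemma lor_ne_zero (x y : ℕ) : Nat.lor x y ≠ 0 ↔ x ≠ 0 ∨ y ≠ 0 := by
  have : Nat.lor x y = 0 ↔ x = 0 ∧ y = 0 := Nat.or_eq_zero_iff
  rw [Ne, this]
  tauto

lemma land_msk (x : ℕ) (L : List (ℕ × ℕ)) :
    Nat.land x (msk L) ≠ 0 ↔ ∃ y ∈ L, Nat.land x y.1 ≠ 0 := by
  induction L with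
  | nil =>
    have : Nat.land x (msk []) = 0 := Nat.and_zero x
    constructor
    · exact fun h => absurd this h
    · rintro ⟨y, hy, _⟩
      simp at hy
  | cons y L ih =>
    have : msk (y :: L) = Nat.lor y.1 (msk L) := rfl
    rw [this, land_lor, lor_ne_zero, ih]
    simp

lemma mem_pstep (L : List (ℕ × ℕ)) (x : ℕ × ℕ) :
    x ∈ pstep L ↔ x ∈ L ∧ ∃ y ∈ L, Nat.land x.2 y.1 ≠ 0 := by
  rw [pstep, lfilter_eq, List.mem_filter, ← land_msk]
  have : ∀ n, (!(Nat.beq n 0)) = true ↔ n ≠ 0 := by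
    intro n
    cases n <;> simp [Nat.beq]
  rw [this]

lemma go_iff (k : ℕ) : ∀ L : List (ℕ × ℕ), L.length ≤ k → (go k L = true ↔ WellFounded (rL L)) := by
  induction k with
  | zero =>
    intro L hL
    have : L = [] := List.eq_nil_of_length_eq_zero (by omega)
    subst this
    constructor
    · exact fun _ => ⟨fun x => ⟨_, fun y hy => by simp [rL] at hy⟩⟩
    · exact fun _ => rfl
  | succ k ih =>
    intro L hL
    have hsub : (pstep L).Sublist L := by
      rw [pstep, lfilter_eq]; exact List.filter_sublist
    have hgo : go (k + 1) L = bif Nat.beq (llen (pstep L)) (llen L) then L.isEmpty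
      else go k (pstep L) := rfl
    rw [hgo, llen_eq, llen_eq]
    by_cases hl : (pstep L).length = L.length
    · have heq : pstep L = L := hsub.eq_of_length hl
      have hb : Nat.beq (pstep L).length L.length = true := by rw [hl]; exact Nat.beq_refl _
      rw [hb, cond_true, List.isEmpty_iff]
      constructor
      · rintro rfl
        exact ⟨fun x => ⟨_, fun y hy => by simp [rL] at hy⟩⟩
      · intro hw
        by_contra hne
        obtain ⟨x0, hx0⟩ := List.exists_mem_of_ne_nil L hne
        obtain ⟨m, hm, hmin⟩ := hw.has_min {x | x ∈ L} ⟨x0, hx0⟩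
        have hm' : m ∈ pstep L := by rw [heq]; exact hm
        obtain ⟨_, y, hy, hxy⟩ := (mem_pstep L m).1 hm'
        exact hmin y hy ⟨hm, hy, hxy⟩
    · have hb : Nat.beq (pstep L).length L.length = false := by
        rw [Bool.eq_false_iff]
        exact fun hh => hl (Nat.eq_of_beq_eq_true hh)
      have hle := hsub.length_le
      rw [hb, cond_false, ih _ (by omega)]
      have hmem : ∀ x, x ∈ pstep L → x ∈ L := fun x hx => ((mem_pstep L x).1 hx).1
      constructor
      · intro hw
        have hout : ∀ x, x ∉ pstep L → Acc (rL L) x := by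
          intro x hx
          refine ⟨_, fun y hy => absurd ?_ hx⟩
          exact (mem_pstep L x).2 ⟨hy.1, y, hy.2.1, hy.2.2⟩
        refine ⟨fun x => hw.induction (C := fun x => Acc (rL L) x) x fun x hx => ?_⟩
        by_cases hxp : x ∈ pstep L
        · refine ⟨_, fun y hy => ?_⟩
          by_cases hyp : y ∈ pstep L
          · exact hx y ⟨hxp, hyp, hy.2.2⟩
          · exact hout y hyp
        · exact hout x hxp
      · intro hw
        exact Subrelation.wf (fun {y x} h => ⟨hmem _ h.1, hmem _ h.2.1, h.2.2⟩) hw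

lemma land_pow (x b : ℕ) : Nat.land x (2 ^ b) ≠ 0 ↔ x.testBit b = true := by
  have : Nat.land x (2 ^ b) = (x.testBit b).toNat * 2 ^ b := Nat.and_two_pow x b
  rw [this]
  cases x.testBit b <;> simp

lemma dg_lt (w i : ℕ) : dg w i < 4 := Nat.mod_lt _ (by norm_num)

lemma nd_adj (a b wa wb a' b' : ℕ) (wa' wb' : ℕ) (hb' : b' < 4) :
    Nat.land (nd a b wa wb).2 (nd a' b' wa' wb').1 ≠ 0 ↔
      ∃ i : Fin 4, dg wa i = a' ∧ dg wb i = b' := by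
  have key : ∀ i, (bt wa wb i).testBit (4 * a' + b') = true ↔ (dg wa i = a' ∧ dg wb i = b') := by
    intro i
    have := dg_lt wb i
    rw [bt, Nat.testBit_two_pow, decide_eq_true_eq]
    omega
  have ho : ∀ x y n : ℕ, (Nat.lor x y).testBit n = true ↔ x.testBit n = true ∨ y.testBit n = true := by
    intro x y n
    have : (Nat.lor x y).testBit n = (x.testBit n || y.testBit n) := Nat.testBit_or x y n
    rw [this, Bool.or_eq_true]
  unfold nd
  simp only
  rw [land_pow, ho, ho, ho, key, key, key, key]
  simp [Fin.exists_fin_succ]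

lemma coalB_iff (c0 c1 c2 c3 : ℕ) :
    coalB c0 c1 c2 c3 = true ↔ Coal ![dec c0, dec c1, dec c2, dec c3] := by
  set c : Fin 4 → ℕ := ![c0, c1, c2, c3] with hc
  set F : Fin 4 → Wd := ![dec c0, dec c1, dec c2, dec c3] with hF
  have hFc : ∀ a i, (F a i : ℕ) = dg (c a) i := by
    intro a i
    fin_cases a <;> rfl
  let node : Fin 4 × Fin 4 → ℕ × ℕ := fun p => nd p.1 p.2 (c p.1) (c p.2)
  let P : List (Fin 4 × Fin 4) := [(0, 1), (0, 2), (0, 3), (1, 0), (1, 2), (1, 3),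
    (2, 0), (2, 1), (2, 3), (3, 0), (3, 1), (3, 2)]
  have hP : ∀ p, p ∈ P ↔ p.1 ≠ p.2 := by decide
  have hL : coalB c0 c1 c2 c3 = go 12 (P.map node) := rfl
  have hadj : ∀ p q : Fin 4 × Fin 4, Nat.land (node p).2 (node q).1 ≠ 0 ↔
      ∃ i, q = (F p.1 i, F p.2 i) := by
    intro p q
    simp only [node]
    rw [nd_adj _ _ _ _ _ _ _ _ q.2.isLt]
    refine exists_congr fun i => ?_
    rw [Prod.ext_iff, Fin.ext_iff, Fin.ext_iff, hFc, hFc]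
    exact and_congr eq_comm eq_comm
  rw [hL, go_iff 12 _ (by simp [P])]
  unfold Coal
  constructor
  · intro h
    refine Subrelation.wf ?_ (InvImage.wf node h)
    intro q p hqp
    obtain ⟨hp, hq, hi⟩ := hqp
    exact ⟨List.mem_map_of_mem ((hP p).2 hp), List.mem_map_of_mem ((hP q).2 hq), (hadj p q).2 hi⟩
  · intro h
    have key : ∀ p, p.1 ≠ p.2 → Acc (rL (P.map node)) (node p) := by
      intro p
      refine h.induction (C := fun p => p.1 ≠ p.2 → Acc (rL (P.map node)) (node p)) p
        fun p ih hp => ?_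
      refine ⟨_, fun y hy => ?_⟩
      obtain ⟨_, hyL, hy2⟩ := hy
      obtain ⟨q, hq, rfl⟩ := List.mem_map.1 hyL
      have hq' := (hP q).1 hq
      exact ih q ⟨hp, hq', (hadj p q).1 hy2⟩ hq'
    refine ⟨fun x => ?_⟩
    by_cases hx : x ∈ P.map node
    · obtain ⟨p, hp, rfl⟩ := List.mem_map.1 hx
      exact key p ((hP p).1 hp)
    · exact ⟨_, fun y hy => absurd hy.1 hx⟩

lemma chi_dec (c0 c1 c2 c3 : ℕ) : chi ![dec c0, dec c1, dec c2, dec c3] =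
    bif coalB c0 c1 c2 c3 then 1 else 0 := by
  unfold chi
  by_cases h : Coal ![dec c0, dec c1, dec c2, dec c3]
  · rw [if_pos h, (coalB_iff c0 c1 c2 c3).2 h]; rfl
  · have : coalB c0 c1 c2 c3 = false := by
      rw [Bool.eq_false_iff]
      exact fun hh => h ((coalB_iff c0 c1 c2 c3).1 hh)
    rw [if_neg h, this]; rfl

lemma chi_ne_zero {F : Fin 4 → Wd} (h : chi F ≠ 0) : Coal F := by
  unfold chi at h
  by_contra hh
  exact h (if_neg hh)

lemma coal_eq {F : Fin 4 → Wd} (h : Coal F) : ∃ a b, a ≠ b ∧ F a = F b := by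
  obtain ⟨p, hp, hmin⟩ := h.has_min {p | p.1 ≠ p.2} ⟨(0, 1), by simp⟩
  refine ⟨p.1, p.2, hp, ?_⟩
  funext i
  by_contra hi
  exact hmin (F p.1 i, F p.2 i) hi ⟨hp, hi, i, rfl⟩

lemma coal_ok {F : Fin 4 → Wd} (h : Coal F) (a b : Fin 4) (hab : a ≠ b) (i : Fin 4) :
    ¬ (F a i = a ∧ F b i = b) ∧ ¬ (F a i = b ∧ F b i = a) := by
  constructor
  · rintro ⟨h1, h2⟩
    exact h.asymmetric (a := (a, b)) (b := (a, b)) ⟨hab, hab, i, by simp [h1, h2]⟩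
      ⟨hab, hab, i, by simp [h1, h2]⟩
  · rintro ⟨h1, h2⟩
    exact h.asymmetric (a := (a, b)) (b := (b, a)) ⟨hab.symm, hab, i, by simp [h1, h2]⟩
      ⟨hab, hab.symm, i, by simp [h1, h2]⟩

lemma mask_disj : ∀ b0 b1 b2 b3 c0 c1 c2 c3 : Bool, (b0 && c0) = false → (b1 && c1) = false →
    (b2 && c2) = false → (b3 && c3) = false →
    Nat.beq (Nat.land
      (Nat.add (cond b0 1 0) (Nat.add (cond b1 2 0) (Nat.add (cond b2 4 0) (cond b3 8 0))))
      (Nat.add (cond c0 1 0) (Nat.add (cond c1 2 0) (Nat.add (cond c2 4 0) (cond c3 8 0))))) 0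
      = true := by
  decide

lemma zm_disj (a b wa wb : ℕ) (h : ∀ i : Fin 4, ¬ (dg wa i = a ∧ dg wb i = b)) :
    Nat.beq (Nat.land (zm wa a) (zm wb b)) 0 = true := by
  have key : ∀ i : Fin 4, (Nat.beq (dg wa i) a && Nat.beq (dg wb i) b) = false := by
    intro i
    rw [Bool.eq_false_iff]
    intro hh
    rw [Bool.and_eq_true] at hh
    exact h i ⟨Nat.eq_of_beq_eq_true hh.1, Nat.eq_of_beq_eq_true hh.2⟩
  exact mask_disj _ _ _ _ _ _ _ _ (key 0) (key 1) (key 2) (key 3)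

lemma okp_of (c : Fin 4 → ℕ) (h : Coal (fun a => dec (c a))) (a b : Fin 4) (hab : a ≠ b) :
    okp a b (c a) (c b) = true := by
  have h1 := zm_disj a b (c a) (c b) (fun i hi => (coal_ok h a b hab i).1
    ⟨Fin.ext hi.1, Fin.ext hi.2⟩)
  have h2 := zm_disj b a (c a) (c b) (fun i hi => (coal_ok h a b hab i).2
    ⟨Fin.ext hi.1, Fin.ext hi.2⟩)
  unfold okp
  change cond (Nat.beq (Nat.land (zm (c a) a) (zm (c b) b)) 0)
    (Nat.beq (Nat.land (zm (c a) b) (zm (c b) a)) 0) false = true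
  rw [h1, h2]
  rfl

lemma eq4_of (x : Fin 4 → ℕ) (h : ∃ a b, a ≠ b ∧ x a = x b) :
    eq4 (x 0) (x 1) (x 2) (x 3) = true := by
  have hb : ∀ m n : ℕ, Nat.beq m n = true ↔ m = n := fun m n =>
    ⟨Nat.eq_of_beq_eq_true, fun h => by rw [h]; exact Nat.beq_refl _⟩
  obtain ⟨a, b, hab, h⟩ := h
  simp only [eq4, Bool.or_eq_true, hb]
  fin_cases a <;> fin_cases b <;> simp_all

lemma leaf_facts (c0 c1 c2 c3 : ℕ) (h0 : c0 < 256) (h1 : c1 < 256) (h2 : c2 < 256) (h3 : c3 < 256)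
    (h : chi ![dec c0, dec c1, dec c2, dec c3] ≠ 0) :
    okp 0 1 c0 c1 = true ∧ okp 0 2 c0 c2 = true ∧ okp 1 2 c1 c2 = true ∧
    eq4 c0 c1 c2 c3 = true ∧ okp 0 3 c0 c3 = true ∧ okp 1 3 c1 c3 = true ∧
    okp 2 3 c2 c3 = true := by
  have hC := chi_ne_zero h
  set c : Fin 4 → ℕ := ![c0, c1, c2, c3] with hc
  have hF : (![dec c0, dec c1, dec c2, dec c3] : Fin 4 → Wd) = fun a => dec (c a) := by
    funext a; fin_cases a <;> rfl
  rw [hF] at hC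
  have hlt : ∀ a, c a < 256 := by
    intro a
    fin_cases a
    · exact h0
    · exact h1
    · exact h2
    · exact h3
  have he : eq4 c0 c1 c2 c3 = true := by
    refine eq4_of c ?_
    obtain ⟨a, b, hab, hh⟩ := coal_eq hC
    refine ⟨a, b, hab, ?_⟩
    rw [← code_dec (c a) (hlt a), ← code_dec (c b) (hlt b)]
    exact congrArg code hh
  exact ⟨okp_of c hC 0 1 (by decide), okp_of c hC 0 2 (by decide), okp_of c hC 1 2 (by decide), he,
    okp_of c hC 0 3 (by decide), okp_of c hC 1 3 (by decide), okp_of c hC 2 3 (by decide)⟩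

lemma lsum_congr {α : Type} {l : List α} {f g : α → ℕ} (h : ∀ x ∈ l, f x = g x) :
    lsum l f = lsum l g := by
  rw [lsum_eq, lsum_eq, List.map_congr_left h]

lemma lsum_zero {α : Type} {l : List α} {f : α → ℕ} (h : ∀ x ∈ l, f x = 0) : lsum l f = 0 := by
  rw [lsum_congr h, lsum_eq]
  simp

lemma coal_comp (F : Fin 4 → Wd) (π : Equiv.Perm (Fin 4)) (h : Coal F) :
    Coal (fun a => F a ∘ π) := by
  refine Subrelation.wf ?_ h
  rintro q p ⟨hp, hq, i, hi⟩
  exact ⟨hp, hq, π i, hi⟩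

lemma chi_comp (w0 w1 w2 w3 : Wd) (π : Equiv.Perm (Fin 4)) :
    chi ![w0 ∘ π, w1 ∘ π, w2 ∘ π, w3 ∘ π] = chi ![w0, w1, w2, w3] := by
  have h1 : (![w0 ∘ π, w1 ∘ π, w2 ∘ π, w3 ∘ π] : Fin 4 → Wd) =
      fun a => (![w0, w1, w2, w3] : Fin 4 → Wd) a ∘ π := by
    funext a; fin_cases a <;> rfl
  rw [h1]
  unfold chi
  congr 1
  rw [eq_iff_iff]
  constructor
  · intro h
    have := coal_comp _ π.symm h
    convert this using 1
    funext a i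
    simp
  · exact coal_comp _ π

lemma cnt_comp (w : Wd) (π : Equiv.Perm (Fin 4)) (x : Fin 4) : cnt (w ∘ π) x = cnt w x :=
  Nat.card_congr (π.subtypeEquiv fun _ => Iff.rfl)

lemma cont_comp (w : Wd) (π : Equiv.Perm (Fin 4)) : cont (w ∘ π) = cont w := by
  rw [cont_eq, cont_eq w]
  simp only [cnt_comp]

lemma sum_comp (r : ℕ) (π : Equiv.Perm (Fin 4)) (g : Wd → ℕ) :
    ∑ w ∈ SS r, g (w ∘ π) = ∑ w ∈ SS r, g w := by
  refine Finset.sum_nbij' (fun w => w ∘ π) (fun w => w ∘ π.symm) ?_ ?_ ?_ ?_ ?_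
  · intro w hw
    rw [mem_SS, cont_comp]; exact (mem_SS _ _).1 hw
  · intro w hw
    rw [mem_SS, cont_comp]; exact (mem_SS _ _).1 hw
  · intro w _
    funext i; simp
  · intro w _
    funext i; simp
  · intro w _; rfl

lemma exists_perm (w w' : Wd) (h : cont w = cont w') : ∃ π : Equiv.Perm (Fin 4), w' = w ∘ π := by
  have h1 := fib_card w' w
  have h2 : ∀ z, Nat.card {x // w' x = z} = Nat.card {y // w y = z} := by
    intro z
    change cnt w' z = cnt w z
    rw [← en_cont, ← en_cont, h]
  rw [if_pos h2] at h1
  have h3 : Nat.card {e : Fin 4 ≃ Fin 4 // ∀ x, w (e x) = w' x} ≠ 0 := by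
    rw [h1]
    exact Finset.prod_ne_zero_iff.2 fun z _ => Nat.factorial_ne_zero _
  obtain ⟨⟨e, he⟩⟩ := (Nat.card_ne_zero.1 h3).1
  exact ⟨e, funext fun x => (he x).symm⟩

noncomputable def EE (r1 r2 r3 : ℕ) (w0 : Wd) : ℕ :=
  ∑ w1 ∈ SS r1, ∑ w2 ∈ SS r2, ∑ w3 ∈ SS r3, chi ![w0, w1, w2, w3]

lemma EE_comp (r1 r2 r3 : ℕ) (w0 : Wd) (π : Equiv.Perm (Fin 4)) :
    EE r1 r2 r3 (w0 ∘ π) = EE r1 r2 r3 w0 := by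
  unfold EE
  rw [← sum_comp r1 π]
  refine Finset.sum_congr rfl fun w1 _ => ?_
  rw [← sum_comp r2 π]
  refine Finset.sum_congr rfl fun w2 _ => ?_
  rw [← sum_comp r3 π]
  refine Finset.sum_congr rfl fun w3 _ => ?_
  exact chi_comp w0 w1 w2 w3 π

lemma dr_eq (r0 r1 r2 r3 : ℕ) : DD r0 r1 r2 r3 = dr r0 r1 r2 r3 := by
  have hDE : DD r0 r1 r2 r3 = ∑ w0 ∈ SS r0, EE r1 r2 r3 w0 := rfl
  rw [hDE, sum_SS, dr]
  have hmem := mem_wordsOf r0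
  revert hmem
  generalize wordsOf r0 = l0
  intro hmem
  cases l0 with
  | nil => rfl
  | cons c0 l =>
    have hc0 := (hmem c0).1 (by simp)
    have h1 : ∀ c ∈ c0 :: l, EE r1 r2 r3 (dec c) = EE r1 r2 r3 (dec c0) := by
      intro c hc
      have hc' := (hmem c).1 hc
      obtain ⟨π, hπ⟩ := exists_perm (dec c0) (dec c)
        (by rw [cont_dec, cont_dec, hc0.2, hc'.2])
      rw [hπ, EE_comp]
    rw [lsum_congr h1, lsum_eq, List.map_const', List.sum_replicate, smul_eq_mul, ← llen_eq]
    change _ = Nat.mul (llen (c0 :: l)) _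
    refine congrArg (Nat.mul (llen (c0 :: l))) ?_
    unfold EE
    rw [sum_SS]
    refine lsum_congr fun c1 m1 => ?_
    rw [sum_SS]
    have hc1 := (mem_wordsOf r1 c1).1 m1
    have inner : ∀ c2 ∈ wordsOf r2, ∀ c3 ∈ wordsOf r3,
        chi ![dec c0, dec c1, dec c2, dec c3] ≠ 0 →
        okp 0 1 c0 c1 = true ∧ okp 0 2 c0 c2 = true ∧ okp 1 2 c1 c2 = true ∧
        eq4 c0 c1 c2 c3 = true ∧ okp 0 3 c0 c3 = true ∧ okp 1 3 c1 c3 = true ∧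
        okp 2 3 c2 c3 = true := fun c2 m2 c3 m3 =>
      leaf_facts c0 c1 c2 c3 hc0.1 hc1.1 ((mem_wordsOf r2 c2).1 m2).1 ((mem_wordsOf r3 c3).1 m3).1
    change _ = cond (okp 0 1 c0 c1) _ _
    cases hk : okp 0 1 c0 c1 with
    | false =>
      rw [cond_false]
      refine lsum_zero fun c2 m2 => ?_
      rw [sum_SS]
      refine lsum_zero fun c3 m3 => ?_
      by_contra hne
      have := (inner c2 m2 c3 m3 hne).1
      rw [hk] at this
      cases this
    | true =>
      rw [cond_true]
      refine lsum_congr fun c2 m2 => ?_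
      rw [sum_SS]
      change _ = cond (okp 0 2 c0 c2 && okp 1 2 c1 c2) _ _
      cases hk2 : (okp 0 2 c0 c2 && okp 1 2 c1 c2) with
      | false =>
        rw [cond_false]
        refine lsum_zero fun c3 m3 => ?_
        by_contra hne
        obtain ⟨_, a1, a2, _⟩ := inner c2 m2 c3 m3 hne
        rw [a1, a2] at hk2
        cases hk2
      | true =>
        rw [cond_true]
        refine lsum_congr fun c3 m3 => ?_
        change _ = cond (eq4 c0 c1 c2 c3 && (okp 0 3 c0 c3 && (okp 1 3 c1 c3 && okp 2 3 c2 c3))) _ _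
        cases hk3 : (eq4 c0 c1 c2 c3 && (okp 0 3 c0 c3 && (okp 1 3 c1 c3 && okp 2 3 c2 c3))) with
        | false =>
          rw [cond_false]
          by_contra hne
          obtain ⟨_, _, _, a1, a2, a3, a4⟩ := inner c2 m2 c3 m3 hne
          rw [a1, a2, a3, a4] at hk3
          cases hk3
        | true =>
          rw [cond_true]
          exact chi_dec c0 c1 c2 c3

lemma DD_witness {r0 r1 r2 r3 : ℕ} (h : DD r0 r1 r2 r3 ≠ 0) : ∃ w0 w1 w2 w3 : Wd,
    cont w0 = r0 ∧ cont w1 = r1 ∧ cont w2 = r2 ∧ cont w3 = r3 ∧ Coal ![w0, w1, w2, w3] := by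
  unfold DD at h
  obtain ⟨w0, m0, h⟩ := Finset.exists_ne_zero_of_sum_ne_zero h
  obtain ⟨w1, m1, h⟩ := Finset.exists_ne_zero_of_sum_ne_zero h
  obtain ⟨w2, m2, h⟩ := Finset.exists_ne_zero_of_sum_ne_zero h
  obtain ⟨w3, m3, h⟩ := Finset.exists_ne_zero_of_sum_ne_zero h
  rw [mem_SS] at m0 m1 m2 m3
  exact ⟨w0, w1, w2, w3, m0, m1, m2, m3, chi_ne_zero h⟩

lemma DD_eq4 {r0 r1 r2 r3 : ℕ} (h : DD r0 r1 r2 r3 ≠ 0) : eq4 r0 r1 r2 r3 = true := by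
  obtain ⟨w0, w1, w2, w3, rfl, rfl, rfl, rfl, hC⟩ := DD_witness h
  refine eq4_of ![cont w0, cont w1, cont w2, cont w3] ?_
  obtain ⟨a, b, hab, hh⟩ := coal_eq hC
  refine ⟨a, b, hab, ?_⟩
  have : ∀ a, (![cont w0, cont w1, cont w2, cont w3] : Fin 4 → ℕ) a =
      cont ((![w0, w1, w2, w3] : Fin 4 → Wd) a) := by
    intro a; fin_cases a <;> rfl
  rw [this, this, hh]

lemma filt_all : ∀ a b c d : Fin 5,
    filt ((a : ℕ) + 32 * (b : ℕ) + 1024 * (c : ℕ) + 32768 * (d : ℕ)) = true := by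
  decide +kernel

lemma filt_of (a b c d : ℕ) (ha : a ≤ 4) (hb : b ≤ 4) (hc : c ≤ 4) (hd : d ≤ 4) :
    filt (a + 32 * b + 1024 * c + 32768 * d) = true :=
  filt_all ⟨a, by omega⟩ ⟨b, by omega⟩ ⟨c, by omega⟩ ⟨d, by omega⟩

lemma both_facts {r0 r1 r2 r3 : ℕ} (h : DD r0 r1 r2 r3 * GG r0 r1 r2 r3 ≠ 0) :
    r0 + r1 + r2 + r3 = 135300 ∧ filt (r0 + r1) = true ∧ filt (r0 + r1 + r2) = true := by
  have h1 : DD r0 r1 r2 r3 ≠ 0 := left_ne_zero_of_mul h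
  have h2 := right_ne_zero_of_mul (right_ne_zero_of_mul h)
  obtain ⟨w0, w1, w2, w3, rfl, rfl, rfl, rfl, -⟩ := DD_witness h1
  obtain ⟨v0, v1, v2, v3, e0, e1, e2, e3, -⟩ := DD_witness h2
  have hs : ∀ b : Fin 4, cnt w0 b + cnt w1 b + cnt w2 b + cnt w3 b = 4 := by
    intro b
    have hv : ∃ v, cont v = tr (cont w0) (cont w1) (cont w2) (cont w3) b := by
      fin_cases b
      · exact ⟨v0, e0⟩
      · exact ⟨v1, e1⟩
      · exact ⟨v2, e2⟩
      · exact ⟨v3, e3⟩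
    obtain ⟨v, hv⟩ := hv
    have hc : ∀ a : Fin 4, cnt v a = cnt ((![w0, w1, w2, w3] : Fin 4 → Wd) a) b := by
      intro a
      rw [← en_cont, hv, en_tr]
    have h4 := cnt_sum v
    rw [hc, hc, hc, hc] at h4
    exact h4
  have s0 := hs 0
  have s1 := hs 1
  have s2 := hs 2
  have s3 := hs 3
  rw [cont_eq w0, cont_eq w1, cont_eq w2, cont_eq w3]
  refine ⟨by omega, ?_, ?_⟩
  · have := filt_of (cnt w0 0 + cnt w1 0) (cnt w0 1 + cnt w1 1) (cnt w0 2 + cnt w1 2)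
      (cnt w0 3 + cnt w1 3) (by omega) (by omega) (by omega) (by omega)
    rw [← this]
    congr 1
    ring
  · have := filt_of (cnt w0 0 + cnt w1 0 + cnt w2 0) (cnt w0 1 + cnt w1 1 + cnt w2 1)
      (cnt w0 2 + cnt w1 2 + cnt w2 2)
      (cnt w0 3 + cnt w1 3 + cnt w2 3) (by omega) (by omega) (by omega) (by omega)
    rw [← this]
    congr 1
    ring

lemma term_eq (r0 r1 r2 r3 : ℕ) : term r0 r1 r2 r3 = DD r0 r1 r2 r3 * GG r0 r1 r2 r3 := by
  unfold term
  cases hk : (eq4 r0 r1 r2 r3 &&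
      ((eq4 (tr r0 r1 r2 r3 0) (tr r0 r1 r2 r3 1) (tr r0 r1 r2 r3 2) (tr r0 r1 r2 r3 3)))) with
  | false =>
    rw [cond_false]
    symm
    by_contra hne
    have h1 := DD_eq4 (left_ne_zero_of_mul hne)
    have h2 := DD_eq4 (right_ne_zero_of_mul (right_ne_zero_of_mul hne))
    rw [h1, h2] at hk
    cases hk
  | true =>
    rw [cond_true, GG, dr_eq, dr_eq]
    generalize dr r0 r1 r2 r3 = d
    cases d with
    | zero => simp
    | succ d => rfl

lemma total_main :
    ∑ r0 ∈ LL, ∑ r1 ∈ LL, ∑ r2 ∈ LL, ∑ r3 ∈ LL, DD r0 r1 r2 r3 * GG r0 r1 r2 r3 = total := by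
  unfold total
  rw [sum_LL]
  refine lsum_congr fun x0 _ => ?_
  rw [sum_LL]
  refine lsum_congr fun x1 _ => ?_
  cases hk : filt (x0.1 + x1.1) with
  | false =>
    rw [cond_false]
    refine Finset.sum_eq_zero fun r2 _ => Finset.sum_eq_zero fun r3 _ => ?_
    by_contra hne
    have := (both_facts hne).2.1
    rw [hk] at this
    cases this
  | true =>
    rw [cond_true, sum_LL]
    refine lsum_congr fun x2 _ => ?_
    cases hk2 : filt (x0.1 + x1.1 + x2.1) with
    | false =>
      rw [cond_false]
      refine Finset.sum_eq_zero fun r3 _ => ?_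
      by_contra hne
      have := (both_facts hne).2.2
      rw [hk2] at this
      cases this
    | true =>
      rw [cond_true, term_eq]
      refine Finset.sum_eq_single _ ?_ ?_
      · intro r3 _ hr
        by_contra hne
        have := (both_facts hne).1
        exact hr (by omega)
      · intro hr
        by_contra hne
        obtain ⟨_, _, _, w3, _, _, _, e3, _⟩ := DD_witness (left_ne_zero_of_mul hne)
        exact hr (e3 ▸ cont_mem w3)

lemma total_eq : total = 5771520 := by decide +kernel

theorem stmt_16 :
    Nat.card {σ : Equiv.Perm (Fin (1 + 1) → Fin 4) // diagCond σ ∧ annCond σ} = 5771520 := by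
  rw [main_sum2, total_main, total_eq]
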